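/- Let d, k be positive integers, W a real d×k matrix, σ > 0, μ ∈ ℝ^d, and let ν_x¹,…,ν_x^k > 2 and ν_ε¹,…,ν_ε^d > 2. Let S_x and S_ε be uniform random variables on (0,1), Z_x a standard Gaussian random row vector in ℝ^k, and Z_ε a standard Gaussian random row vector in ℝ^d, all four mutually independent. Define the comonotone random vectors V and U by V_j := F_{ν_x^j}⁻¹(S_x)/ν_x^j and U_i := F_{ν_ε^i}⁻¹(S_ε)/ν_ε^i, where F_ν is the cumulative distribution function of Gamma(ν/2, 1/2) and F_ν⁻¹ its quantile function on (0,1). Define X componentwise by X_j := V_j^{−1/2}·Z_{x,j}, ε componentwise by ε_i := σ·U_i^{−1/2}·Z_{ε,i}, and Y := μ + X·Wᵀ + ε. Then the covariance matrix of Y equals W·diag(ν_x¹/(ν_x¹−2), …, ν_x^k/(ν_x^k−2))·Wᵀ + σ²·diag(ν_ε¹/(ν_ε¹−2), …, ν_ε^d/(ν_ε^d−2)). -/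

import Mathlib

open Matrix MeasureTheory ProbabilityTheory

/-- The law of a standard Gaussian random row vector in `ℝⁿ`:
the product of `n` independent standard normal distributions. -/
noncomputable def stdGaussianPi (n : ℕ) : Measure (Fin n → ℝ) :=
  Measure.pi fun _ => gaussianReal 0 1

/-- Mean vector `E[X]` of a random row vector `X`. -/
noncomputable def meanVec {Ω : Type*} [MeasureSpace Ω] {n : ℕ}
    (X : Ω → Fin n → ℝ) : Fin n → ℝ :=
  fun i => ∫ ω, X ω i

/-- Covariance matrix `E[(X − E X)ᵀ (X − E X)]` of a random row vector `X`. -/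
noncomputable def covMatrix {Ω : Type*} [MeasureSpace Ω] {n : ℕ}
    (X : Ω → Fin n → ℝ) : Matrix (Fin n) (Fin n) ℝ :=
  Matrix.of fun i j => ∫ ω, (X ω i - meanVec X i) * (X ω j - meanVec X j)

/-- The inverse moment of a gamma distribution, as a Lebesgue integral. -/
theorem lintegral_inv_gammaMeasure {a r : ℝ} (ha : 1 < a) (hr : 0 < r) :
    ∫⁻ x, ENNReal.ofReal x⁻¹ ∂gammaMeasure a r = ENNReal.ofReal (r / (a - 1)) := by
  have hm : Measurable (gammaPDF a r) := (measurable_gammaPDFReal a r).ennreal_ofReal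
  have hm' : Measurable (gammaPDF (a - 1) r) :=
    (measurable_gammaPDFReal (a - 1) r).ennreal_ofReal
  have ha' : 0 < a - 1 := by linarith
  rw [gammaMeasure, lintegral_withDensity_eq_lintegral_mul _ hm (by fun_prop)]
  have h : ∀ᵐ x : ℝ, (gammaPDF a r * fun x => ENNReal.ofReal x⁻¹) x
      = ENNReal.ofReal (r / (a - 1)) * gammaPDF (a - 1) r x := by
    filter_upwards [Measure.ae_ne volume (0 : ℝ)] with x hx
    rcases lt_or_gt_of_ne hx with hx | hx
    · simp [gammaPDF_of_neg hx]
    · have hG : Real.Gamma a = (a - 1) * Real.Gamma (a - 1) := by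
        simpa using Real.Gamma_add_one ha'.ne'
      have hGp := Real.Gamma_pos_of_pos ha'
      have hra : r ^ a = r ^ (a - 1) * r := by
        rw [← Real.rpow_add_one hr.ne']; simp
      have hxa : x ^ (a - 1) = x ^ (a - 1 - 1) * x := by
        rw [← Real.rpow_add_one hx.ne']; simp
      rw [Pi.mul_apply, gammaPDF_of_nonneg hx.le, gammaPDF_of_nonneg hx.le,
        ← ENNReal.ofReal_mul' (by positivity), ← ENNReal.ofReal_mul (by positivity),
        hG, hra, hxa]
      congr 1
      field_simp
  rw [lintegral_congr_ae h, lintegral_const_mul _ hm', lintegral_gammaPDF_eq_one ha' hr, mul_one]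

theorem ae_pos_gammaMeasure (a r : ℝ) : ∀ᵐ x ∂gammaMeasure a r, 0 < x := by
  have hm : Measurable (gammaPDF a r) := (measurable_gammaPDFReal a r).ennreal_ofReal
  rw [gammaMeasure, ae_withDensity_iff hm]
  filter_upwards [Measure.ae_ne volume (0 : ℝ)] with x hx h
  exact lt_of_le_of_ne (not_lt.1 fun h' => h (gammaPDF_of_neg h')) hx.symm

theorem integrable_inv_gammaMeasure {a r : ℝ} (ha : 1 < a) (hr : 0 < r) :
    Integrable (fun x => x⁻¹) (gammaMeasure a r) := by
  refine ⟨by fun_prop, ?_⟩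
  rw [hasFiniteIntegral_iff_ofReal, lintegral_inv_gammaMeasure ha hr]
  · exact ENNReal.ofReal_lt_top
  · filter_upwards [ae_pos_gammaMeasure a r] with x hx using (inv_pos.2 hx).le

theorem integral_inv_gammaMeasure {a r : ℝ} (ha : 1 < a) (hr : 0 < r) :
    ∫ x, x⁻¹ ∂gammaMeasure a r = r / (a - 1) := by
  rw [integral_eq_lintegral_of_nonneg_ae _ (by fun_prop), lintegral_inv_gammaMeasure ha hr,
    ENNReal.toReal_ofReal (div_nonneg hr.le (by linarith))]
  filter_upwards [ae_pos_gammaMeasure a r] with x hx using (inv_pos.2 hx).le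

section Quantile

variable {P : Measure ℝ} {q : ℝ → ℝ}

theorem monotoneOn_of_cdf_comp_eq (hq : ∀ s ∈ Set.Ioo (0 : ℝ) 1, cdf P (q s) = s) :
    MonotoneOn q (Set.Ioo 0 1) := by
  intro s hs t ht hst
  by_contra! h
  have := monotone_cdf P h.le
  rw [hq s hs, hq t ht] at this
  exact h.ne' (by rw [le_antisymm hst this])

/-- Inverse transform sampling. -/
theorem map_quantile_uniform [IsProbabilityMeasure P]
    (hq : ∀ s ∈ Set.Ioo (0 : ℝ) 1, cdf P (q s) = s) :
    Measure.map q (volume.restrict (Set.Ioo (0 : ℝ) 1)) = P := by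
  have hqm : AEMeasurable q (volume.restrict (Set.Ioo (0 : ℝ) 1)) :=
    aemeasurable_restrict_of_monotoneOn measurableSet_Ioo (monotoneOn_of_cdf_comp_eq hq)
  have : IsProbabilityMeasure (volume.restrict (Set.Ioo (0 : ℝ) 1)) := ⟨by simp⟩
  have := Measure.isProbabilityMeasure_map hqm
  refine Measure.ext_of_Iic _ _ fun t => ?_
  have h0 := cdf_nonneg P t
  have h1 := cdf_le_one P t
  rw [Measure.map_apply_of_aemeasurable hqm measurableSet_Iic, ← ofReal_cdf P t,
    Measure.restrict_apply' measurableSet_Ioo]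
  apply le_antisymm
  · calc volume (q ⁻¹' Set.Iic t ∩ Set.Ioo 0 1) ≤ volume (Set.Ioc 0 (cdf P t)) := by
          refine measure_mono fun s hs => ⟨hs.2.1, ?_⟩
          rw [← hq s hs.2]
          exact monotone_cdf P hs.1
      _ = _ := by simp
  · calc ENNReal.ofReal (cdf P t) = volume (Set.Ioo 0 (cdf P t)) := by simp
      _ ≤ _ := by
          refine measure_mono fun s hs => ?_
          have hs' : s ∈ Set.Ioo (0 : ℝ) 1 := ⟨hs.1, hs.2.trans_le h1⟩
          refine ⟨?_, hs'⟩
          by_contra h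
          have := monotone_cdf P (not_le.1 h).le
          rw [hq s hs'] at this
          exact this.not_gt hs.2

end Quantile

/-- The random scale `(F_ν⁻¹(s)/ν)^{-1/2}` is square integrable under the uniform law on `(0,1)`,
with second moment `ν/(ν-2)`. -/
theorem memLp_and_integral_sq_scale {ν : ℝ} (hν : 2 < ν) {q : ℝ → ℝ}
    (hq : ∀ s ∈ Set.Ioo (0 : ℝ) 1, cdf (gammaMeasure (ν / 2) (1 / 2)) (q s) = s) :
    MemLp (fun s => (√(q s / ν))⁻¹) 2 (volume.restrict (Set.Ioo (0 : ℝ) 1)) ∧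
      ∫ s in Set.Ioo (0 : ℝ) 1, ((√(q s / ν))⁻¹) ^ 2 = ν / (ν - 2) := by
  have := isProbabilityMeasure_gammaMeasure (a := ν / 2) (r := 1 / 2) (by linarith) (by norm_num)
  have hqm : AEMeasurable q (volume.restrict (Set.Ioo (0 : ℝ) 1)) :=
    aemeasurable_restrict_of_monotoneOn measurableSet_Ioo (monotoneOn_of_cdf_comp_eq hq)
  have hmap := map_quantile_uniform hq
  have hpos : ∀ᵐ s ∂volume.restrict (Set.Ioo (0 : ℝ) 1), 0 < q s :=
    ae_of_ae_map hqm (hmap.symm ▸ ae_pos_gammaMeasure _ _)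
  have hsq : (fun s => ((√(q s / ν))⁻¹) ^ 2)
      =ᵐ[volume.restrict (Set.Ioo (0 : ℝ) 1)] fun s => ν * (q s)⁻¹ := by
    filter_upwards [hpos] with s hs
    rw [inv_pow, Real.sq_sqrt (div_nonneg hs.le (by linarith)), inv_div, div_eq_mul_inv]
  have ha : 1 < ν / 2 := by linarith
  have hint : Integrable (fun s => (q s)⁻¹) (volume.restrict (Set.Ioo (0 : ℝ) 1)) := by
    have h := integrable_inv_gammaMeasure ha (r := 1 / 2) (by norm_num)
    rw [← hmap] at h
    exact h.comp_aemeasurable hqm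
  constructor
  · have hm : AEMeasurable (fun s => (√(q s / ν))⁻¹) (volume.restrict (Set.Ioo (0 : ℝ) 1)) :=
      (hqm.div_const ν).sqrt.inv
    rw [memLp_two_iff_integrable_sq hm.aestronglyMeasurable, integrable_congr hsq]
    exact hint.const_mul ν
  · have h := integral_inv_gammaMeasure ha (r := 1 / 2) (by norm_num)
    rw [← hmap, integral_map hqm (by fun_prop)] at h
    rw [integral_congr_ae hsq, integral_const_mul, h]
    have : ν - 2 ≠ 0 := by linarith
    have : ν / 2 - 1 ≠ 0 := by linarith
    field_simp

instance isProbabilityMeasure_stdGaussianPi (n : ℕ) : IsProbabilityMeasure (stdGaussianPi n) := by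
  unfold stdGaussianPi; infer_instance

theorem measurePreserving_eval_stdGaussianPi {n : ℕ} (i : Fin n) :
    MeasurePreserving (fun z : Fin n → ℝ => z i) (stdGaussianPi n) (gaussianReal 0 1) :=
  measurePreserving_eval (fun _ : Fin n => gaussianReal 0 1) i

theorem memLp_eval_stdGaussianPi {n : ℕ} (i : Fin n) :
    MemLp (fun z : Fin n → ℝ => z i) 2 (stdGaussianPi n) :=
  (memLp_id_gaussianReal 2).comp_measurePreserving (measurePreserving_eval_stdGaussianPi i)

theorem integral_eval_stdGaussianPi {n : ℕ} (i : Fin n) : ∫ z, z i ∂stdGaussianPi n = 0 := by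
  rw [stdGaussianPi, integral_eval, integral_id_gaussianReal]

theorem integral_eval_mul_eval_stdGaussianPi {n : ℕ} (i j : Fin n) :
    ∫ z, z i * z j ∂stdGaussianPi n = if i = j then 1 else 0 := by
  split_ifs with h
  · subst h
    have h1 : ∫ x, x * x ∂gaussianReal 0 1 = 1 := by
      have := variance_eq_sub (memLp_id_gaussianReal (μ := 0) (v := 1) 2)
      rw [variance_id_gaussianReal] at this
      simpa [pow_two] using this.symm
    rw [← h1, ← (measurePreserving_eval_stdGaussianPi i).map_eq, integral_map
      (measurePreserving_eval_stdGaussianPi i).measurable.aemeasurable (by fun_prop)]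
  · have hind : IndepFun (fun z : Fin n → ℝ => z i) (fun z => z j) (stdGaussianPi n) :=
      (iIndepFun_pi (μ := fun _ : Fin n => gaussianReal 0 1) (X := fun _ x => x)
        fun _ => aemeasurable_id).indepFun h
    rw [hind.integral_fun_mul_eq_mul_integral (memLp_eval_stdGaussianPi i).aestronglyMeasurable
      (memLp_eval_stdGaussianPi j).aestronglyMeasurable, integral_eval_stdGaussianPi, zero_mul]

/-- Covariance matrix of an affine image of a centred family of uncorrelated variables. -/
theorem covMatrix_affine_of_uncorrelated {Ω : Type*} [MeasureSpace Ω]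
    [IsProbabilityMeasure (ℙ : Measure Ω)] {κ : Type*} [Fintype κ] [DecidableEq κ] {n : ℕ}
    (μ : Fin n → ℝ) (M : Matrix (Fin n) κ ℝ) (ξ : κ → Ω → ℝ) (c : κ → ℝ)
    (hξ : ∀ a, MemLp (ξ a) 2 ℙ) (hmean : ∀ a, ∫ ω, ξ a ω = 0)
    (hcov : ∀ a b, ∫ ω, ξ a ω * ξ b ω = if a = b then c a else 0) :
    covMatrix (fun ω i => μ i + ∑ a, M i a * ξ a ω) = M * diagonal c * Mᵀ := by
  have hi : ∀ a, Integrable (ξ a) ℙ := fun a => (hξ a).integrable (by norm_num)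
  have hm : ∀ i, meanVec (fun ω i => μ i + ∑ a, M i a * ξ a ω) i = μ i := by
    intro i
    have h := fun a => (hi a).const_mul (M i a)
    simp only [meanVec]
    rw [integral_add (integrable_const _) (integrable_finsetSum _ fun a _ => h a),
      integral_finsetSum _ fun a _ => h a]
    simp [integral_const_mul, hmean]
  ext i j
  simp only [covMatrix, of_apply, hm, add_sub_cancel_left, Finset.sum_mul_sum]
  have h2 : ∀ a b, Integrable (fun ω => M i a * ξ a ω * (M j b * ξ b ω)) ℙ := fun a b =>
    ((hξ a).const_mul (M i a)).integrable_mul ((hξ b).const_mul (M j b))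
  rw [integral_finsetSum _ fun a _ => integrable_finsetSum _ fun b _ => h2 a b]
  simp_rw [integral_finsetSum _ fun b _ => h2 _ b, mul_mul_mul_comm (M i _), integral_const_mul,
    hcov]
  rw [mul_apply]
  simp only [mul_ite, mul_zero, Finset.sum_ite_eq, Finset.mem_univ, if_true, mul_diagonal,
    transpose_apply]
  exact Finset.sum_congr rfl fun a _ => by ring

/-- Covariance of the observation vector under the Grouped-t GSt PPCA model
(zero skewness): the comonotone scale vectors are `V_j = F_{ν_x^j}⁻¹(S_x)/ν_x^j` and
`U_i = F_{ν_ε^i}⁻¹(S_ε)/ν_ε^i`, where `F_ν` is the CDF of `Gamma(ν/2, 1/2)` (chi-square with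
`ν` degrees of freedom) and `F_ν⁻¹` its quantile function on `(0,1)`, with `S_x`, `S_ε` uniform
on `(0,1)` and `Z_x`, `Z_ε` standard Gaussian, all four mutually independent. With
`X_j = V_j^{−1/2} Z_{x,j}`, `ε_i = σ U_i^{−1/2} Z_{ε,i}` and `Y = μ + X Wᵀ + ε`,
`Cov(Y) = W diag(ν_x^j/(ν_x^j−2)) Wᵀ + σ² diag(ν_ε^i/(ν_ε^i−2))`. -/
theorem stmt_15 {Ω : Type*} [MeasureSpace Ω] [IsProbabilityMeasure (ℙ : Measure Ω)]
    (d k : ℕ) (hd : 0 < d) (hk : 0 < k)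
    (W : Matrix (Fin d) (Fin k) ℝ) (σ : ℝ) (hσ : 0 < σ) (μ : Fin d → ℝ)
    (νx : Fin k → ℝ) (hνx : ∀ j, 2 < νx j)
    (νε : Fin d → ℝ) (hνε : ∀ i, 2 < νε i)
    -- quantile functions of the chi-square distributions
    (Finvx : Fin k → ℝ → ℝ)
    (hFinvx : ∀ j, ∀ s ∈ Set.Ioo (0 : ℝ) 1,
      0 < Finvx j s ∧ cdf (gammaMeasure (νx j / 2) (1 / 2)) (Finvx j s) = s)
    (Finvε : Fin d → ℝ → ℝ)
    (hFinvε : ∀ i, ∀ s ∈ Set.Ioo (0 : ℝ) 1,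
      0 < Finvε i s ∧ cdf (gammaMeasure (νε i / 2) (1 / 2)) (Finvε i s) = s)
    (Sx Sε : Ω → ℝ) (Zx : Ω → Fin k → ℝ) (Zε : Ω → Fin d → ℝ)
    (hSxm : Measurable Sx) (hSεm : Measurable Sε) (hZxm : Measurable Zx) (hZεm : Measurable Zε)
    (hSx : Measure.map Sx ℙ = volume.restrict (Set.Ioo (0 : ℝ) 1))
    (hSε : Measure.map Sε ℙ = volume.restrict (Set.Ioo (0 : ℝ) 1))
    (hZx : Measure.map Zx ℙ = stdGaussianPi k)
    (hZε : Measure.map Zε ℙ = stdGaussianPi d)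
    (hindep : Measure.map (fun ω => (Sx ω, Sε ω, Zx ω, Zε ω)) ℙ
      = (volume.restrict (Set.Ioo (0 : ℝ) 1)).prod
          ((volume.restrict (Set.Ioo (0 : ℝ) 1)).prod
            ((stdGaussianPi k).prod (stdGaussianPi d))))
    -- the comonotone scale vectors
    (V : Ω → Fin k → ℝ) (hV : V = fun ω j => Finvx j (Sx ω) / νx j)
    (U : Ω → Fin d → ℝ) (hU : U = fun ω i => Finvε i (Sε ω) / νε i)
    (X : Ω → Fin k → ℝ) (hX : X = fun ω j => (Real.sqrt (V ω j))⁻¹ * Zx ω j)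
    (ε : Ω → Fin d → ℝ) (hε : ε = fun ω i => σ * (Real.sqrt (U ω i))⁻¹ * Zε ω i)
    (Y : Ω → Fin d → ℝ) (hY : Y = fun ω => μ + X ω ᵥ* Wᵀ + ε ω) :
    covMatrix Y
      = W * Matrix.diagonal (fun j => νx j / (νx j - 2)) * Wᵀ
        + σ ^ 2 • Matrix.diagonal (fun i => νε i / (νε i - 2)) := by
  classical
  have : IsProbabilityMeasure (volume.restrict (Set.Ioo (0 : ℝ) 1)) := ⟨by simp⟩
  set u : Measure ℝ := volume.restrict (Set.Ioo (0 : ℝ) 1)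
  have hSm : Measurable fun ω => (Sx ω, Sε ω) := by fun_prop
  have hZm : Measurable fun ω => (Zx ω, Zε ω) := by fun_prop
  have hassoc : MeasurePreserving
      (fun p : ℝ × ℝ × (Fin k → ℝ) × (Fin d → ℝ) => ((p.1, p.2.1), p.2.2))
      (u.prod (u.prod ((stdGaussianPi k).prod (stdGaussianPi d))))
      ((u.prod u).prod ((stdGaussianPi k).prod (stdGaussianPi d))) :=
    (measurePreserving_prodAssoc u u ((stdGaussianPi k).prod (stdGaussianPi d))).symm
  have hjoint : Measure.map (fun ω => ((Sx ω, Sε ω), (Zx ω, Zε ω))) ℙ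
      = (u.prod u).prod ((stdGaussianPi k).prod (stdGaussianPi d)) := by
    rw [← hassoc.map_eq, ← hindep, Measure.map_map hassoc.measurable (by fun_prop)]
    rfl
  have hSlaw : Measure.map (fun ω => (Sx ω, Sε ω)) ℙ = u.prod u := by
    have := congrArg Measure.fst hjoint
    rwa [Measure.fst_map_prodMk hZm, Measure.fst_prod] at this
  have hZlaw : Measure.map (fun ω => (Zx ω, Zε ω)) ℙ
      = (stdGaussianPi k).prod (stdGaussianPi d) := by
    have := congrArg Measure.snd hjoint
    rwa [Measure.snd_map_prodMk hSm, Measure.snd_prod] at this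
  have hSZ : IndepFun (fun ω => (Sx ω, Sε ω)) (fun ω => (Zx ω, Zε ω)) ℙ := by
    rw [indepFun_iff_map_prod_eq_prod_map_map hSm.aemeasurable hZm.aemeasurable, hSlaw, hZlaw,
      hjoint]
  have hZZ : IndepFun Zx Zε ℙ := by
    rw [indepFun_iff_map_prod_eq_prod_map_map hZxm.aemeasurable hZεm.aemeasurable, hZx, hZε,
      hZlaw]
  have hmpx : MeasurePreserving Zx ℙ (stdGaussianPi k) := ⟨hZxm, hZx⟩
  have hmpε : MeasurePreserving Zε ℙ (stdGaussianPi d) := ⟨hZεm, hZε⟩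
  have hscx := fun j => memLp_and_integral_sq_scale (hνx j) fun s hs => (hFinvx j s hs).2
  have hscε := fun i => memLp_and_integral_sq_scale (hνε i) fun s hs => (hFinvε i s hs).2
  let sc : Fin k ⊕ Fin d → ℝ × ℝ → ℝ := Sum.elim (fun j p => (√(Finvx j p.1 / νx j))⁻¹)
    fun i p => (√(Finvε i p.2 / νε i))⁻¹
  let N : Fin k ⊕ Fin d → (Fin k → ℝ) × (Fin d → ℝ) → ℝ :=
    Sum.elim (fun j p => p.1 j) fun i p => p.2 i
  let c : Fin k ⊕ Fin d → ℝ := Sum.elim (fun j => νx j / (νx j - 2)) fun i => νε i / (νε i - 2)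
  have hscL : ∀ a, MemLp (sc a) 2 (u.prod u) := by
    rintro (j | i)
    · exact (hscx j).1.comp_measurePreserving measurePreserving_fst
    · exact (hscε i).1.comp_measurePreserving measurePreserving_snd
  have hscI : ∀ a, ∫ p, sc a p * sc a p ∂u.prod u = c a := by
    rintro (j | i)
    · have h := integral_fun_fst (μ := u) (ν := u) fun s => (√(Finvx j s / νx j))⁻¹ ^ 2
      simpa [sc, c, ← pow_two, (hscx j).2] using h.trans (by rw [(hscx j).2, probReal_univ, one_smul])
    · have h := integral_fun_snd (μ := u) (ν := u) fun s => (√(Finvε i s / νε i))⁻¹ ^ 2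
      simpa [sc, c, ← pow_two, (hscε i).2] using h.trans (by rw [(hscε i).2, probReal_univ, one_smul])
  have hmpS : MeasurePreserving (fun ω => (Sx ω, Sε ω)) ℙ (u.prod u) := ⟨hSm, hSlaw⟩
  have hNm : ∀ a, Measurable (N a) := by
    rintro (j | i) <;> simp only [N, Sum.elim_inl, Sum.elim_inr] <;> fun_prop
  have hNL : ∀ a, MemLp (fun ω => N a (Zx ω, Zε ω)) 2 ℙ := by
    rintro (j | i)
    · exact (memLp_eval_stdGaussianPi j).comp_measurePreserving hmpx
    · exact (memLp_eval_stdGaussianPi i).comp_measurePreserving hmpε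
  have hx_int : ∀ f : (Fin k → ℝ) → ℝ, Measurable f →
      ∫ ω, f (Zx ω) = ∫ z, f z ∂stdGaussianPi k := fun f hf => by
    rw [← hZx, integral_map hZxm.aemeasurable hf.aestronglyMeasurable]
  have hε_int : ∀ f : (Fin d → ℝ) → ℝ, Measurable f →
      ∫ ω, f (Zε ω) = ∫ z, f z ∂stdGaussianPi d := fun f hf => by
    rw [← hZε, integral_map hZεm.aemeasurable hf.aestronglyMeasurable]
  have hNmean : ∀ a, ∫ ω, N a (Zx ω, Zε ω) = 0 := by
    rintro (j | i)
    · exact (hx_int (fun z => z j) (by fun_prop)).trans (integral_eval_stdGaussianPi j)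
    · exact (hε_int (fun z => z i) (by fun_prop)).trans (integral_eval_stdGaussianPi i)
  have hcross : ∀ j i, ∫ ω, Zx ω j * Zε ω i = 0 := fun j i => by
    have h : IndepFun (fun ω => Zx ω j) (fun ω => Zε ω i) ℙ :=
      hZZ.comp (measurable_pi_apply j) (measurable_pi_apply i)
    rw [h.integral_fun_mul_eq_mul_integral (by fun_prop) (by fun_prop),
      show ∫ ω, Zx ω j = 0 from hNmean (Sum.inl j), zero_mul]
  have hNcov : ∀ a b, ∫ ω, N a (Zx ω, Zε ω) * N b (Zx ω, Zε ω) = if a = b then 1 else 0 := by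
    rintro (j | i) (j' | i')
    · simpa [N] using (hx_int (fun z => z j * z j') (by fun_prop)).trans
        (integral_eval_mul_eval_stdGaussianPi j j')
    · simpa [N] using hcross j i'
    · simpa [N, mul_comm] using hcross j' i
    · simpa [N] using (hε_int (fun z => z i * z i') (by fun_prop)).trans
        (integral_eval_mul_eval_stdGaussianPi i i')
  have hscL' : ∀ a, MemLp (fun ω => sc a (Sx ω, Sε ω)) 2 ℙ := fun a =>
    (hscL a).comp_measurePreserving hmpS
  have hind : ∀ f : ℝ × ℝ → ℝ, ∀ g : (Fin k → ℝ) × (Fin d → ℝ) → ℝ, AEMeasurable f (u.prod u) →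
      Measurable g → IndepFun (fun ω => f (Sx ω, Sε ω)) (fun ω => g (Zx ω, Zε ω)) ℙ :=
    fun f g hf hg => hSZ.comp₀ hSm.aemeasurable hZm.aemeasurable (hSlaw ▸ hf) hg.aemeasurable
  have hscm := fun a => (hscL a).aestronglyMeasurable.aemeasurable
  let ξ : Fin k ⊕ Fin d → Ω → ℝ := fun a ω => sc a (Sx ω, Sε ω) * N a (Zx ω, Zε ω)
  have hY' : Y = fun ω i => μ i + ∑ a, fromCols W (σ • (1 : Matrix (Fin d) (Fin d) ℝ)) i a
      * ξ a ω := by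
    subst hY hX hε hV hU
    ext ω i
    simp [ξ, sc, N, vecMul, dotProduct, one_apply, add_assoc, mul_comm, mul_left_comm]
  rw [hY', covMatrix_affine_of_uncorrelated μ _ ξ c]
  · ext i j
    rw [Matrix.add_apply, mul_apply, mul_apply]
    simp [c, mul_diagonal, diagonal_apply, one_apply, mul_comm, mul_left_comm, pow_two]
    split_ifs with hij
    · rw [hij, mul_assoc]
    · rfl
  · intro a
    have hm : AEStronglyMeasurable (ξ a) ℙ :=
      (hscL' a).aestronglyMeasurable.mul (hNL a).aestronglyMeasurable
    rw [memLp_two_iff_integrable_sq hm]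
    simp only [ξ, mul_pow]
    exact (hind (fun p => sc a p ^ 2) (fun p => N a p ^ 2) ((hscm a).pow_const 2)
      ((hNm a).pow_const 2)).integrable_mul (hscL' a).integrable_sq (hNL a).integrable_sq
  · intro a
    rw [(hind _ _ (hscm a) (hNm a)).integral_fun_mul_eq_mul_integral
      (hscL' a).aestronglyMeasurable (hNL a).aestronglyMeasurable, hNmean, mul_zero]
  · intro a b
    have h := (hind _ _ ((hscm a).mul (hscm b)) ((hNm a).mul (hNm b))
      ).integral_fun_mul_eq_mul_integral
      ((hscL' a).aestronglyMeasurable.mul (hscL' b).aestronglyMeasurable)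
      ((hNL a).aestronglyMeasurable.mul (hNL b).aestronglyMeasurable)
    simp only [ξ, mul_mul_mul_comm (sc a _)]
    refine h.trans ?_
    simp only [Pi.mul_apply, hNcov]
    split_ifs with hab
    · subst hab
      rw [mul_one, ← hscI a, ← hSlaw, integral_map hSm.aemeasurable]
      rw [hSlaw]
      exact ((hscm a).mul (hscm a)).aestronglyMeasurable
    · rw [mul_zero]
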